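/- arXiv:2208.01479 — 3 statements merged into one kernel-verified Lean document; each statement's English description precedes it below -/
import Mathlib

section
/- Let L be a lattice and u ≤ v elements of L such that the interval [u,v] is quasi-dismantling for L. Then the complement of Set.Icc u v is a sublattice of L: for all x, y ∈ L with x ∉ Set.Icc u v and y ∉ Set.Icc u v, we have x ⊔ y ∉ Set.Icc u v and x ⊓ y ∉ Set.Icc u v. -/
theorem compl_Icc_sublattice_of_quasiDismantling {L : Type*} [Lattice L]
    (u v : L) (huv : u ≤ v)
    (hsup : ∀ x y : L, x ≤ v → y ≤ v → u ≤ x ⊔ y → u ≤ x ∨ u ≤ y)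
    (hinf : ∀ x y : L, u ≤ x → u ≤ y → x ⊓ y ≤ v → x ≤ v ∨ y ≤ v) :
    ∀ x y : L, x ∉ Set.Icc u v → y ∉ Set.Icc u v →
      x ⊔ y ∉ Set.Icc u v ∧ x ⊓ y ∉ Set.Icc u v := by
  intro x y hx hy
  refine ⟨fun ⟨hu, hv⟩ => ?_, fun ⟨hu, hv⟩ => ?_⟩
  · have hxv : x ≤ v := le_sup_left.trans hv
    have hyv : y ≤ v := le_sup_right.trans hv
    exact (hsup x y hxv hyv hu).elim (fun h => hx ⟨h, hxv⟩) (fun h => hy ⟨h, hyv⟩)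
  · have hux : u ≤ x := hu.trans inf_le_left
    have huy : u ≤ y := hu.trans inf_le_right
    exact (hinf x y hux huy hv).elim (fun h => hx ⟨hux, h⟩) (fun h => hy ⟨huy, h⟩)
end

section
/- Let L be a lattice with a bounded order (⊥ and ⊤) and u ≤ v elements of L such that the interval [u,v] is dismantling for L (quasi-dismantling with u ≠ ⊥ and v ≠ ⊤). Then the complement of Set.Icc u v is a complete sublattice of L: ⊥ ∉ Set.Icc u v, ⊤ ∉ Set.Icc u v, and for every finite set T : Finset L with x ∉ Set.Icc u v for all x ∈ T, both T.sup id ∉ Set.Icc u v and T.inf id ∉ Set.Icc u v. -/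
theorem compl_Icc_complete_sublattice_of_dismantling {L : Type*} [Lattice L]
    [BoundedOrder L] (u v : L) (huv : u ≤ v) (hu : u ≠ ⊥) (hv : v ≠ ⊤)
    (hsup : ∀ x y : L, x ≤ v → y ≤ v → u ≤ x ⊔ y → u ≤ x ∨ u ≤ y)
    (hinf : ∀ x y : L, u ≤ x → u ≤ y → x ⊓ y ≤ v → x ≤ v ∨ y ≤ v) :
    (⊥ : L) ∉ Set.Icc u v ∧ (⊤ : L) ∉ Set.Icc u v ∧
      ∀ T : Finset L, (∀ x ∈ T, x ∉ Set.Icc u v) →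
        T.sup id ∉ Set.Icc u v ∧ T.inf id ∉ Set.Icc u v := by
  have hbot : (⊥ : L) ∉ Set.Icc u v := fun h => hu (le_bot_iff.mp h.1)
  have htop : (⊤ : L) ∉ Set.Icc u v := fun h => hv (top_le_iff.mp h.2)
  refine ⟨hbot, htop, fun T hT => ⟨?_, ?_⟩⟩
  · refine Finset.sup_induction (p := (· ∉ Set.Icc u v)) hbot ?_ hT
    intro x hx y hy h
    have hxv := le_sup_left.trans h.2
    have hyv := le_sup_right.trans h.2
    exact (hsup x y hxv hyv h.1).elim (fun hux => hx ⟨hux, hxv⟩) (fun huy => hy ⟨huy, hyv⟩)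
  · refine Finset.inf_induction (p := (· ∉ Set.Icc u v)) htop ?_ hT
    intro x hx y hy h
    have hux := h.1.trans inf_le_left
    have huy := h.1.trans inf_le_right
    exact (hinf x y hux huy h.2).elim (fun hxv => hx ⟨hux, hxv⟩) (fun hyv => hy ⟨huy, hyv⟩)
end

section
/- Let L be a finite lattice with ⊥ and ⊤, and let [u₁,v₁] and [u₂,v₂] (with u₁ ≤ v₁ and u₂ ≤ v₂) be two dismantling intervals for L such that ¬(Set.Icc u₂ v₂ ⊆ Set.Icc u₁ v₁). Let A := (Set.Icc u₁ v₁)ᶜ. Then there exist u', v' ∈ A with u' ≤ v', u' ≠ ⊥ and v' ≠ ⊤ such that: (1) Set.Icc u₂ v₂ \ Set.Icc u₁ v₁ = {x ∈ A | u' ≤ x ∧ x ≤ v'}, i.e., the set difference is an interval of the suborder A; (2) for all x, y ∈ A with x ≤ v' and y ≤ v', u' ≤ x ⊔ y implies u' ≤ x or u' ≤ y; and (3) for all x, y ∈ A with u' ≤ x and u' ≤ y, x ⊓ y ≤ v' implies x ≤ v' or y ≤ v'. (Since A is closed under ⊔ and ⊓, these are exactly the conditions that the interval [u',v'] of the lattice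 A is dismantling for A.) -/
theorem SupClosed.exists_isGreatest {L : Type*} [SemilatticeSup L] {D : Set L}
    (hD : SupClosed D) (hfin : D.Finite) (hne : D.Nonempty) : ∃ m, IsGreatest D m := by
  obtain ⟨m, hm⟩ := hfin.exists_maximal hne
  exact ⟨m, hm.prop, fun x hx =>
    le_sup_right.trans (hm.le_of_ge (hD hm.prop hx) le_sup_left)⟩

theorem InfClosed.exists_isLeast {L : Type*} [SemilatticeInf L] {D : Set L}
    (hD : InfClosed D) (hfin : D.Finite) (hne : D.Nonempty) : ∃ m, IsLeast D m := by
  obtain ⟨m, hm⟩ := hfin.exists_minimal hne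
  exact ⟨m, hm.prop, fun x hx =>
    (hm.le_of_le (hD hm.prop hx) inf_le_left).trans inf_le_right⟩


theorem dismantling_intervals_stay_dismantling {L : Type*} [Lattice L]
    [BoundedOrder L] [Fintype L]
    (u₁ v₁ u₂ v₂ : L) (h₁ : u₁ ≤ v₁) (h₂ : u₂ ≤ v₂)
    (hu₁ : u₁ ≠ ⊥) (hv₁ : v₁ ≠ ⊤) (hu₂ : u₂ ≠ ⊥) (hv₂ : v₂ ≠ ⊤)
    (hsup₁ : ∀ x y : L, x ≤ v₁ → y ≤ v₁ → u₁ ≤ x ⊔ y → u₁ ≤ x ∨ u₁ ≤ y)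
    (hinf₁ : ∀ x y : L, u₁ ≤ x → u₁ ≤ y → x ⊓ y ≤ v₁ → x ≤ v₁ ∨ y ≤ v₁)
    (hsup₂ : ∀ x y : L, x ≤ v₂ → y ≤ v₂ → u₂ ≤ x ⊔ y → u₂ ≤ x ∨ u₂ ≤ y)
    (hinf₂ : ∀ x y : L, u₂ ≤ x → u₂ ≤ y → x ⊓ y ≤ v₂ → x ≤ v₂ ∨ y ≤ v₂)
    (hne : ¬ Set.Icc u₂ v₂ ⊆ Set.Icc u₁ v₁)
    (A : Set L) (hA : A = (Set.Icc u₁ v₁)ᶜ) :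
    ∃ u' ∈ A, ∃ v' ∈ A, u' ≤ v' ∧ u' ≠ ⊥ ∧ v' ≠ ⊤ ∧
      Set.Icc u₂ v₂ \ Set.Icc u₁ v₁ = {x | x ∈ A ∧ u' ≤ x ∧ x ≤ v'} ∧
      (∀ x ∈ A, ∀ y ∈ A, x ≤ v' → y ≤ v' → u' ≤ x ⊔ y → u' ≤ x ∨ u' ≤ y) ∧
      (∀ x ∈ A, ∀ y ∈ A, u' ≤ x → u' ≤ y → x ⊓ y ≤ v' → x ≤ v' ∨ y ≤ v') := by
  subst hA
  have hsup : SupClosed (Set.Icc u₂ v₂ \ Set.Icc u₁ v₁) := by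
    rintro x ⟨hx, hx'⟩ y ⟨hy, hy'⟩
    refine ⟨⟨hx.1.trans le_sup_left, sup_le hx.2 hy.2⟩, fun h => ?_⟩
    have hxv := le_sup_left.trans h.2
    have hyv := le_sup_right.trans h.2
    exact (hsup₁ x y hxv hyv h.1).elim (fun k => hx' ⟨k, hxv⟩) fun k => hy' ⟨k, hyv⟩
  have hinf : InfClosed (Set.Icc u₂ v₂ \ Set.Icc u₁ v₁) := by
    rintro x ⟨hx, hx'⟩ y ⟨hy, hy'⟩
    refine ⟨⟨le_inf hx.1 hy.1, inf_le_left.trans hx.2⟩, fun h => ?_⟩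
    have hxu := h.1.trans inf_le_left
    have hyu := h.1.trans inf_le_right
    exact (hinf₁ x y hxu hyu h.2).elim (fun k => hx' ⟨hxu, k⟩) fun k => hy' ⟨hyu, k⟩
  have hnonempty := Set.sdiff_nonempty.mpr hne
  obtain ⟨u, hu, hu_le⟩ := hinf.exists_isLeast (Set.toFinite _) hnonempty
  obtain ⟨v, hv, le_hv⟩ := hsup.exists_isGreatest (Set.toFinite _) hnonempty
  refine ⟨u, hu.2, v, hv.2, hu_le hv, ne_bot_of_le_ne_bot hu₂ hu.1.1,
    ne_top_of_le_ne_top hv₂ hv.1.2, ?_, ?_, ?_⟩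
  · ext x
    exact ⟨fun hx => ⟨hx.2, hu_le hx, le_hv hx⟩,
      fun hx => ⟨⟨hu.1.1.trans hx.2.1, hx.2.2.trans hv.1.2⟩, hx.1⟩⟩
  · intro x hx y hy hxv hyv h
    have hxv₂ := hxv.trans hv.1.2
    have hyv₂ := hyv.trans hv.1.2
    exact (hsup₂ x y hxv₂ hyv₂ (hu.1.1.trans h)).imp
      (fun k => hu_le ⟨⟨k, hxv₂⟩, hx⟩) fun k => hu_le ⟨⟨k, hyv₂⟩, hy⟩
  · intro x hx y hy hux huy h
    have hux₂ := hu.1.1.trans hux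
    have huy₂ := hu.1.1.trans huy
    exact (hinf₂ x y hux₂ huy₂ (h.trans hv.1.2)).imp
      (fun k => le_hv ⟨⟨hux₂, k⟩, hx⟩) fun k => le_hv ⟨⟨huy₂, k⟩, hy⟩
end
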